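/- arXiv:2212.13658 — 5 statements merged into one kernel-verified Lean document; each statement's English description precedes it below -/
import Mathlib

section
/- Let d ≥ 1 and let ℓ : [0,∞) → [0,∞) satisfy (A1,i): ℓ(0) = 0 and ℓ(ru) ≥ rℓ(u) for all r ∈ (0,1) and u > 0. Then for any Borel probability measures P₀, P₁ on ℝ^d, T(P₀,P₁) = Ṽ₁(P₀,P₁), where T is the Monge–Kantorovich cost with cost function L(u) = ℓ(|u|) and Ṽ₁ is the modified Lagrangian cost defined via N₁. -/
open MeasureTheory Set Filter
open scoped ENNReal NNReal Classical

noncomputable section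

/-- `ℝ^d` with the Euclidean norm. -/
abbrev Vec (d : ℕ) := EuclideanSpace ℝ (Fin d)

/-- essential supremum of `|φ|` on `[0,t]` (`‖φ‖_{∞,t}`), as an extended nonnegative real. -/
def eSupT {d : ℕ} (φ : ℝ → Vec d) (t : ℝ) : ℝ≥0∞ :=
  essSup (fun s => (‖φ s‖₊ : ℝ≥0∞)) (volume.restrict (Icc (0:ℝ) t))

/-- `‖φ‖_∞` on `[0,1]`. -/
def eSup01 {d : ℕ} (φ : ℝ → Vec d) : ℝ≥0∞ := eSupT φ 1

/-- `N₁(φ)_t`. -/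
def N1T {d : ℕ} (φ : ℝ → Vec d) (t : ℝ) : ℝ :=
  if (∫ s in (0:ℝ)..t, φ s) ≠ 0 then t * (eSupT φ t).toReal / ‖∫ s in (0:ℝ)..t, φ s‖ else 1

/-- `N₂(φ)_t`. -/
def N2T {d : ℕ} (φ : ℝ → Vec d) (t : ℝ) : ℝ :=
  if 0 < (∫ s in (0:ℝ)..t, ‖φ s‖) then t * (eSupT φ t).toReal / (∫ s in (0:ℝ)..t, ‖φ s‖) else 1

/-- `N₁(φ) = N₁(φ)₁`. -/
def N1 {d : ℕ} (φ : ℝ → Vec d) : ℝ := N1T φ 1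

/-- `N₂(φ) = N₂(φ)₁`. -/
def N2 {d : ℕ} (φ : ℝ → Vec d) : ℝ := N2T φ 1

/-- the position at time `t` of the absolutely continuous path starting at `ξ`
with velocity `φ`. -/
def pathAt {d : ℕ} (ξ : Vec d) (φ : ℝ → Vec d) (t : ℝ) : Vec d := ξ + ∫ s in (0:ℝ)..t, φ s

/-- the endpoint `X(1)` of the path starting at `ξ` with velocity `φ`. -/
def endPt {d : ℕ} (ξ : Vec d) (φ : ℝ → Vec d) : Vec d := ξ + ∫ s in (0:ℝ)..1, φ s

/-- The Monge–Kantorovich cost `T(P₀,P₁) = inf E[L(X₁ - X₀)]`, the infimum being over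
pairs of random variables, on some probability space, with laws `P₀` and `P₁`. -/
def MKcost {d : ℕ} (L : Vec d → ℝ) (P₀ P₁ : Measure (Vec d)) : ℝ≥0∞ :=
  sInf { c | ∃ (Ω : Type) (_ : MeasureSpace Ω), IsProbabilityMeasure (volume : Measure Ω) ∧
    ∃ (X₀ X₁ : Ω → Vec d), Measurable X₀ ∧ Measurable X₁ ∧
      Measure.map X₀ volume = P₀ ∧ Measure.map X₁ volume = P₁ ∧
      c = ∫⁻ ω, ENNReal.ofReal (L (X₁ ω - X₀ ω)) }

/-- `(X₀, X₁)` is a minimizer of `T(P₀,P₁)`. -/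
def IsTMin {d : ℕ} (L : Vec d → ℝ) (P₀ P₁ : Measure (Vec d)) (Ω : Type) [MeasureSpace Ω]
    (X₀ X₁ : Ω → Vec d) : Prop :=
  IsProbabilityMeasure (volume : Measure Ω) ∧ Measurable X₀ ∧ Measurable X₁ ∧
  Measure.map X₀ volume = P₀ ∧ Measure.map X₁ volume = P₁ ∧
  (∫⁻ ω, ENNReal.ofReal (L (X₁ ω - X₀ ω))) = MKcost L P₀ P₁

/-- The stochastic process determined by the (measurable) initial point `ξ` and velocity
process `φ`, namely `X(ω,t) = ξ ω + ∫₀ᵗ φ(ω,s) ds`, is a member of `𝒜_∞(P₀,P₁)`: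
its paths are a.s. absolutely continuous with essentially bounded derivative and
`X(0), X(1)` have laws `P₀, P₁`. -/
def IsAdmissible {d : ℕ} (P₀ P₁ : Measure (Vec d)) (Ω : Type) [MeasureSpace Ω]
    (ξ : Ω → Vec d) (φ : Ω → ℝ → Vec d) : Prop :=
  IsProbabilityMeasure (volume : Measure Ω) ∧ Measurable ξ ∧ Measurable (Function.uncurry φ) ∧
  (∀ᵐ ω ∂(volume : Measure Ω), eSup01 (φ ω) < ⊤) ∧
  Measure.map ξ volume = P₀ ∧ Measure.map (fun ω => endPt (ξ ω) (φ ω)) volume = P₁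

/-- `∫₀¹ Lᵢ(t, φ) dt` where `Lᵢ(t,φ) = Nᵢ(φ) ℓ(|φ(t)|/Nᵢ(φ))`; `N` is `N₁` or `N₂`. -/
def pathCost {d : ℕ} (ℓ : ℝ → ℝ) (N : (ℝ → Vec d) → ℝ) (φ : ℝ → Vec d) : ℝ≥0∞ :=
  ∫⁻ t in Icc (0:ℝ) 1, ENNReal.ofReal (N φ * ℓ (‖φ t‖ / N φ))

/-- The modified Lagrangian cost `Ṽᵢ(P₀,P₁)`; take `N := N₁` resp. `N := N₂`. -/
def Vtilde {d : ℕ} (ℓ : ℝ → ℝ) (N : (ℝ → Vec d) → ℝ) (P₀ P₁ : Measure (Vec d)) : ℝ≥0∞ :=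
  sInf { c | ∃ (Ω : Type) (_ : MeasureSpace Ω) (ξ : Ω → Vec d) (φ : Ω → ℝ → Vec d),
    IsAdmissible P₀ P₁ Ω ξ φ ∧ c = ∫⁻ ω, pathCost ℓ N (φ ω) }

/-- `X(·)` (given by start `ξ` and velocity `φ`) is a minimizer of `Ṽᵢ(P₀,P₁)`. -/
def IsVtildeMin {d : ℕ} (ℓ : ℝ → ℝ) (N : (ℝ → Vec d) → ℝ) (P₀ P₁ : Measure (Vec d))
    (Ω : Type) [MeasureSpace Ω] (ξ : Ω → Vec d) (φ : Ω → ℝ → Vec d) : Prop :=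
  IsAdmissible P₀ P₁ Ω ξ φ ∧ (∫⁻ ω, pathCost ℓ N (φ ω)) = Vtilde ℓ N P₀ P₁

/-- `X(t;x,y,A) = x + (|A∩[0,t]|/|A|)(y-x)` if `x ≠ y` and `|A| > 0`, else `x`
(for `A ⊆ [0,1]`). -/
def XPath {d : ℕ} (x y : Vec d) (A : Set ℝ) (t : ℝ) : Vec d :=
  if x ≠ y ∧ 0 < volume A then
    x + (((volume (A ∩ Icc (0:ℝ) t)).toReal) / ((volume A).toReal)) • (y - x)
  else x

/-- the velocity (a.e. derivative) of `t ↦ X(t;x,y,A)` (for `A ⊆ [0,1]`). -/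
def XVel {d : ℕ} (x y : Vec d) (A : Set ℝ) (s : ℝ) : Vec d :=
  if x ≠ y ∧ 0 < volume A then
    (if s ∈ A then ((volume A).toReal)⁻¹ • (y - x) else 0)
  else 0

/-- `A : Ω → Set ℝ` is a random measurable subset of `[0,1]`. -/
def IsRandomSet (Ω : Type) [MeasureSpace Ω] (A : Ω → Set ℝ) : Prop :=
  (∀ ω, A ω ⊆ Icc (0:ℝ) 1) ∧ MeasurableSet {p : Ω × ℝ | p.2 ∈ A p.1}

/-- `V(P₀,P₁;B)`: the value of the stochastic optimal transport over pairs `(X,M)` with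
`X ∈ 𝒜_∞(P₀,P₁)`, `M` a nonnegative random variable with law in `B` and `‖X'‖_∞ ≤ M` a.s. -/
def Vval {d : ℕ} (ℓ : ℝ → ℝ) (P₀ P₁ : Measure (Vec d)) (B : Set (Measure ℝ)) : ℝ≥0∞ :=
  sInf { c | ∃ (Ω : Type) (_ : MeasureSpace Ω), IsProbabilityMeasure (volume : Measure Ω) ∧
    ∃ (ξ : Ω → Vec d) (φ : Ω → ℝ → Vec d) (M : Ω → ℝ),
      Measurable ξ ∧ Measurable (Function.uncurry φ) ∧ Measurable M ∧
      (∀ᵐ ω ∂(volume : Measure Ω), 0 ≤ M ω) ∧ Measure.map M volume ∈ B ∧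
      (∀ᵐ ω ∂(volume : Measure Ω), eSup01 (φ ω) ≤ ENNReal.ofReal (M ω)) ∧
      Measure.map ξ volume = P₀ ∧ Measure.map (fun ω => endPt (ξ ω) (φ ω)) volume = P₁ ∧
      c = ∫⁻ ω, ∫⁻ t in Icc (0:ℝ) 1, ENNReal.ofReal (ℓ ‖φ ω t‖) }

/-- `T^V(P₀,P₁;B) = inf E[ℓ(M) M⁻¹ |X₁-X₀| ; M > 0]` over `(X₀,X₁,M) ∈ Π_∞(P₀,P₁;B)`. -/
def TVval {d : ℕ} (ℓ : ℝ → ℝ) (P₀ P₁ : Measure (Vec d)) (B : Set (Measure ℝ)) : ℝ≥0∞ :=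
  sInf { c | ∃ (Ω : Type) (_ : MeasureSpace Ω), IsProbabilityMeasure (volume : Measure Ω) ∧
    ∃ (X₀ X₁ : Ω → Vec d) (M : Ω → ℝ),
      Measurable X₀ ∧ Measurable X₁ ∧ Measurable M ∧
      (∀ᵐ ω ∂(volume : Measure Ω), 0 ≤ M ω) ∧ Measure.map M volume ∈ B ∧
      (∀ᵐ ω ∂(volume : Measure Ω), ‖X₁ ω - X₀ ω‖ ≤ M ω) ∧
      Measure.map X₀ volume = P₀ ∧ Measure.map X₁ volume = P₁ ∧
      c = ∫⁻ ω in {ω | 0 < M ω}, ENNReal.ofReal (ℓ (M ω) / M ω * ‖X₁ ω - X₀ ω‖) }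

/-- `((ξ,φ), M)` is an admissible pair for `V(P₀,P₁;B)`. -/
def IsVvalAdmissible {d : ℕ} (P₀ P₁ : Measure (Vec d)) (B : Set (Measure ℝ)) (Ω : Type)
    [MeasureSpace Ω] (ξ : Ω → Vec d) (φ : Ω → ℝ → Vec d) (M : Ω → ℝ) : Prop :=
  IsProbabilityMeasure (volume : Measure Ω) ∧
  Measurable ξ ∧ Measurable (Function.uncurry φ) ∧ Measurable M ∧
  (∀ᵐ ω ∂(volume : Measure Ω), 0 ≤ M ω) ∧ Measure.map M volume ∈ B ∧
  (∀ᵐ ω ∂(volume : Measure Ω), eSup01 (φ ω) ≤ ENNReal.ofReal (M ω)) ∧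
  Measure.map ξ volume = P₀ ∧ Measure.map (fun ω => endPt (ξ ω) (φ ω)) volume = P₁

/-- `((ξ,φ), M)` is a minimizer of `V(P₀,P₁;B)`. -/
def IsVvalMin {d : ℕ} (ℓ : ℝ → ℝ) (P₀ P₁ : Measure (Vec d)) (B : Set (Measure ℝ)) (Ω : Type)
    [MeasureSpace Ω] (ξ : Ω → Vec d) (φ : Ω → ℝ → Vec d) (M : Ω → ℝ) : Prop :=
  IsVvalAdmissible P₀ P₁ B Ω ξ φ M ∧
  (∫⁻ ω, ∫⁻ t in Icc (0:ℝ) 1, ENNReal.ofReal (ℓ ‖φ ω t‖)) = Vval ℓ P₀ P₁ B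

/-- `(X₀,X₁,M)` is an admissible triplet in `Π_∞(P₀,P₁;B)`. -/
def IsTVAdmissible {d : ℕ} (P₀ P₁ : Measure (Vec d)) (B : Set (Measure ℝ)) (Ω : Type)
    [MeasureSpace Ω] (X₀ X₁ : Ω → Vec d) (M : Ω → ℝ) : Prop :=
  IsProbabilityMeasure (volume : Measure Ω) ∧ Measurable X₀ ∧ Measurable X₁ ∧ Measurable M ∧
  (∀ᵐ ω ∂(volume : Measure Ω), 0 ≤ M ω) ∧ Measure.map M volume ∈ B ∧
  (∀ᵐ ω ∂(volume : Measure Ω), ‖X₁ ω - X₀ ω‖ ≤ M ω) ∧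
  Measure.map X₀ volume = P₀ ∧ Measure.map X₁ volume = P₁

/-- `(X₀,X₁,M)` is a minimizer of `T^V(P₀,P₁;B)`. -/
def IsTVMin {d : ℕ} (ℓ : ℝ → ℝ) (P₀ P₁ : Measure (Vec d)) (B : Set (Measure ℝ)) (Ω : Type)
    [MeasureSpace Ω] (X₀ X₁ : Ω → Vec d) (M : Ω → ℝ) : Prop :=
  IsTVAdmissible P₀ P₁ B Ω X₀ X₁ M ∧
  (∫⁻ ω in {ω | 0 < M ω}, ENNReal.ofReal (ℓ (M ω) / M ω * ‖X₁ ω - X₀ ω‖)) = TVval ℓ P₀ P₁ B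


/-- the unconstrained value `inf{E[∫₀¹ ℓ(|X'(t)|) dt] : X ∈ 𝒜_∞(P₀,P₁)}`. -/
def VInfPlain {d : ℕ} (ℓ : ℝ → ℝ) (P₀ P₁ : Measure (Vec d)) : ℝ≥0∞ :=
  sInf { c | ∃ (Ω : Type) (_ : MeasureSpace Ω) (ξ : Ω → Vec d) (φ : Ω → ℝ → Vec d),
    IsAdmissible P₀ P₁ Ω ξ φ ∧ c = ∫⁻ ω, ∫⁻ t in Icc (0:ℝ) 1, ENNReal.ofReal (ℓ ‖φ ω t‖) }

/-- the value `V(P₀,P₁) = inf{E[∫₀¹ L(X'(t)) dt] : X ∈ 𝒜(P₀,P₁)}`, over stochastic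
processes with a.s. absolutely continuous (integrable derivative) paths. -/
def Vplain {d : ℕ} (L : Vec d → ℝ) (P₀ P₁ : Measure (Vec d)) : ℝ≥0∞ :=
  sInf { c | ∃ (Ω : Type) (_ : MeasureSpace Ω), IsProbabilityMeasure (volume : Measure Ω) ∧
    ∃ (ξ : Ω → Vec d) (φ : Ω → ℝ → Vec d),
      Measurable ξ ∧ Measurable (Function.uncurry φ) ∧
      (∀ᵐ ω ∂(volume : Measure Ω), IntegrableOn (φ ω) (Icc (0:ℝ) 1)) ∧
      Measure.map ξ volume = P₀ ∧ Measure.map (fun ω => endPt (ξ ω) (φ ω)) volume = P₁ ∧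
      c = ∫⁻ ω, ∫⁻ t in Icc (0:ℝ) 1, ENNReal.ofReal (L (φ ω t)) }

/-- the (topological) support of a Borel measure on `ℝ^d`. -/
def msupport {d : ℕ} (μ : Measure (Vec d)) : Set (Vec d) :=
  {x | ∀ ε : ℝ, 0 < ε → 0 < μ (Metric.ball x ε)}

end
theorem aux_pointwise {d : ℕ} (ℓ : ℝ → ℝ)
    (hℓnn : ∀ u : ℝ, 0 ≤ u → 0 ≤ ℓ u) (hℓ0 : ℓ 0 = 0)
    (hA1i : ∀ r u : ℝ, 0 < r → r < 1 → 0 < u → r * ℓ u ≤ ℓ (r * u))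
    (φ : ℝ → Vec d) (hfin : eSup01 φ < ⊤) :
    ENNReal.ofReal (ℓ ‖∫ s in (0:ℝ)..1, φ s‖) ≤ pathCost ℓ N1 φ := by
  by_cases hv : (∫ s in (0:ℝ)..1, φ s) = 0
  · simp [hv, hℓ0]
  have hN : N1 φ = (eSup01 φ).toReal / ‖∫ s in (0:ℝ)..1, φ s‖ := by
    simp [N1, N1T, hv, eSup01]
  unfold pathCost
  rw [hN]
  have hle : ‖∫ s in (0:ℝ)..1, φ s‖ₑ ≤ ∫⁻ t in Icc (0:ℝ) 1, ‖φ t‖ₑ := by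
    rw [intervalIntegral.integral_of_le zero_le_one, ← integral_Icc_eq_integral_Ioc]
    exact enorm_integral_le_lintegral_enorm _
  have hae : ∀ᵐ t ∂(volume.restrict (Icc (0:ℝ) 1)), ‖φ t‖ₑ ≤ eSup01 φ :=
    ae_le_essSup (f := fun s => (‖φ s‖₊ : ℝ≥0∞))
  set v := ∫ s in (0:ℝ)..1, φ s with hvdef
  have hvpos : 0 < ‖v‖ := norm_pos_iff.mpr hv
  have hS0 : 0 < eSup01 φ := by
    have h1 : ∫⁻ t in Icc (0:ℝ) 1, ‖φ t‖ₑ ≤ eSup01 φ := by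
      calc _ ≤ ∫⁻ t in Icc (0:ℝ) 1, eSup01 φ := lintegral_mono_ae hae
        _ = _ := by simp
    exact lt_of_lt_of_le (by simpa using hv) (hle.trans h1)
  set S := (eSup01 φ).toReal with hSdef
  have hSpos : 0 < S := ENNReal.toReal_pos hS0.ne' hfin.ne
  have hNpos : 0 < S / ‖v‖ := div_pos hSpos hvpos
  have hlv : 0 ≤ ℓ ‖v‖ := hℓnn _ hvpos.le
  have key : ∀ᵐ t ∂(volume.restrict (Icc (0:ℝ) 1)),
      ‖φ t‖ₑ * ENNReal.ofReal (ℓ ‖v‖ / ‖v‖) ≤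
        ENNReal.ofReal (S / ‖v‖ * ℓ (‖φ t‖ / (S / ‖v‖))) := by
    filter_upwards [hae] with t ht
    have hφS : ‖φ t‖ ≤ S := by
      have := ENNReal.toReal_mono hfin.ne ht
      simpa using this
    rw [← ofReal_norm, ← ENNReal.ofReal_mul (norm_nonneg _)]
    apply ENNReal.ofReal_le_ofReal
    have hr : ‖φ t‖ / (S / ‖v‖) = (‖φ t‖ / S) * ‖v‖ := by field_simp
    have hl : ‖φ t‖ * (ℓ ‖v‖ / ‖v‖) = S / ‖v‖ * ((‖φ t‖ / S) * ℓ ‖v‖) := by field_simp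
    rw [hr, hl]
    apply mul_le_mul_of_nonneg_left _ hNpos.le
    rcases (norm_nonneg (φ t)).eq_or_lt with h0 | h0
    · simp [← h0, hℓ0]
    rcases hφS.eq_or_lt with h1 | h1
    · rw [h1, div_self hSpos.ne']; simp
    · exact hA1i _ _ (div_pos h0 hSpos) ((div_lt_one hSpos).2 h1) hvpos
  calc ENNReal.ofReal (ℓ ‖v‖) = ‖v‖ₑ * ENNReal.ofReal (ℓ ‖v‖ / ‖v‖) := by
        rw [← ofReal_norm, ← ENNReal.ofReal_mul (norm_nonneg _)]
        congr 1; field_simp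
    _ ≤ (∫⁻ t in Icc (0:ℝ) 1, ‖φ t‖ₑ) * ENNReal.ofReal (ℓ ‖v‖ / ‖v‖) := by gcongr
    _ = ∫⁻ t in Icc (0:ℝ) 1, ‖φ t‖ₑ * ENNReal.ofReal (ℓ ‖v‖ / ‖v‖) :=
        (lintegral_mul_const' _ _ ENNReal.ofReal_ne_top).symm
    _ ≤ _ := lintegral_mono_ae key

theorem aux_const {d : ℕ} (ℓ : ℝ → ℝ) (hℓ0 : ℓ 0 = 0) (v : Vec d) :
    pathCost ℓ N1 (fun _ => v) = ENNReal.ofReal (ℓ ‖v‖) := by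
  by_cases hv : v = 0
  · simp [pathCost, hv, hℓ0]
  have hN : N1 (fun _ : ℝ => v) = 1 := by
    have hμ : (volume.restrict (Icc (0:ℝ) 1)) ≠ 0 := by
      intro h
      have := congrArg (fun m => m univ) h
      simp at this
    simp [N1, N1T, hv, eSupT, essSup_const _ hμ]
  simp [pathCost, hN]

/-- Theorem 2.1 (i) of Mikami–Yamamoto: under (A1,i),
`T(P₀,P₁) = Ṽ₁(P₀,P₁)` for all Borel probability measures `P₀, P₁` on `ℝ^d`. -/
theorem statement0 {d : ℕ} (hd : 1 ≤ d) (ℓ : ℝ → ℝ)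
    (hℓnn : ∀ u : ℝ, 0 ≤ u → 0 ≤ ℓ u) (hℓ0 : ℓ 0 = 0)
    (hA1i : ∀ r u : ℝ, 0 < r → r < 1 → 0 < u → r * ℓ u ≤ ℓ (r * u))
    (P₀ P₁ : Measure (Vec d)) [IsProbabilityMeasure P₀] [IsProbabilityMeasure P₁] :
    MKcost (fun u => ℓ ‖u‖) P₀ P₁ = Vtilde ℓ N1 P₀ P₁ := by
  apply le_antisymm
  · refine le_sInf ?_
    rintro c ⟨Ω, mΩ, ξ, φ, ⟨hP, hξ, hφ, hfin, h0, h1⟩, rfl⟩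
    have hm : Measurable (fun ω => ∫ s in (0:ℝ)..1, φ ω s) := by
      simp only [intervalIntegral.integral_of_le zero_le_one]
      exact (hφ.stronglyMeasurable.integral_prod_right
        (ν := volume.restrict (Ioc (0:ℝ) 1))).measurable
    have hm1 : Measurable (fun ω => endPt (ξ ω) (φ ω)) := hξ.add hm
    refine le_trans (sInf_le ⟨Ω, mΩ, hP, ξ, fun ω => endPt (ξ ω) (φ ω), hξ, hm1, h0, h1, rfl⟩) ?_
    apply lintegral_mono_ae
    filter_upwards [hfin] with ω hω
    simpa [endPt] using aux_pointwise ℓ hℓnn hℓ0 hA1i (φ ω) hω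
  · refine le_sInf ?_
    rintro c ⟨Ω, mΩ, hP, X₀, X₁, hX₀, hX₁, h0, h1, rfl⟩
    refine sInf_le ⟨Ω, mΩ, X₀, fun ω _ => X₁ ω - X₀ ω, ⟨hP, hX₀, ?_, ?_, h0, ?_⟩, ?_⟩
    · exact (hX₁.sub hX₀).comp measurable_fst
    · refine Eventually.of_forall fun ω => ?_
      refine lt_of_le_of_lt (essSup_le_of_ae_le (‖X₁ ω - X₀ ω‖₊ : ℝ≥0∞) ?_) ENNReal.coe_lt_top
      exact Eventually.of_forall fun _ => le_rfl
    · simpa [endPt] using h1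
    · exact lintegral_congr fun ω => (aux_const ℓ hℓ0 _).symm
end

section
/- Let d ≥ 1 and let ℓ : [0,∞) → [0,∞) satisfy (A1,i): ℓ(0) = 0 and ℓ(ru) ≥ rℓ(u) for all r ∈ (0,1), u > 0. Let P₀, P₁ be Borel probability measures on ℝ^d. Suppose (X₀,X₁) is a minimizer of T(P₀,P₁) (with cost L(u) = ℓ(|u|)) and A ⊆ [0,1] is a random measurable set defined on the same probability space with P(|A| > 0 | X₀ ≠ X₁) = 1. Then the process t ↦ X(t; X₀, X₁, A) is a minimizer of Ṽ₁(P₀,P₁). -/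
open MeasureTheory Set Filter
open scoped ENNReal NNReal Classical

open MeasureTheory Set Filter
open scoped ENNReal NNReal Classical

lemma aux_lower {d : ℕ} (ℓ : ℝ → ℝ)
    (hℓnn : ∀ u : ℝ, 0 ≤ u → 0 ≤ ℓ u) (hℓ0 : ℓ 0 = 0)
    (hA1i : ∀ r u : ℝ, 0 < r → r < 1 → 0 < u → r * ℓ u ≤ ℓ (r * u))
    (φ : ℝ → Vec d) (hφ : Measurable φ) (hfin : eSup01 φ < ⊤) :
    ENNReal.ofReal (ℓ ‖∫ s in (0:ℝ)..1, φ s‖) ≤ pathCost ℓ N1 φ := by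
  by_cases hI : (∫ s in (0:ℝ)..1, φ s) = 0
  · simp [hI, hℓ0]
  set I := ∫ s in (0:ℝ)..1, φ s with hIdef
  have hIpos : 0 < ‖I‖ := norm_pos_iff.mpr hI
  set M := (eSupT φ 1).toReal with hM
  have hfin' : eSupT φ 1 ≠ ⊤ := hfin.ne
  have hae : ∀ᵐ t ∂(volume.restrict (Icc (0:ℝ) 1)), ‖φ t‖ ≤ M := by
    have h := ENNReal.ae_le_essSup (μ := volume.restrict (Icc (0:ℝ) 1))
      (fun s => (‖φ s‖₊ : ℝ≥0∞))
    filter_upwards [h] with t ht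
    have h2 : (‖φ t‖₊ : ℝ≥0∞) ≤ eSupT φ 1 := ht
    have h3 := ENNReal.toReal_mono hfin' h2
    simpa using h3
  have hIM : ‖I‖ ≤ M := by
    have h := intervalIntegral.norm_integral_le_of_norm_le_const_ae (a := (0:ℝ)) (b := 1)
      (f := φ) (C := M) (by
        rw [ae_restrict_iff' measurableSet_Icc] at hae
        filter_upwards [hae] with t ht ht2
        rw [uIoc_of_le zero_le_one] at ht2
        exact ht ⟨ht2.1.le, ht2.2⟩)
    simpa using h
  have hMpos : 0 < M := lt_of_lt_of_le hIpos hIM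
  have hN : N1 φ = M / ‖I‖ := by
    unfold N1 N1T
    rw [if_pos hI]
    simp [hM, hIdef]
  have hNpos : 0 < N1 φ := by rw [hN]; positivity
  have hc : 0 ≤ ℓ ‖I‖ / ‖I‖ := div_nonneg (hℓnn _ hIpos.le) hIpos.le
  have key : ∀ᵐ t ∂(volume.restrict (Icc (0:ℝ) 1)),
      ENNReal.ofReal (ℓ ‖I‖ / ‖I‖) * ‖φ t‖ₑ ≤ ENNReal.ofReal (N1 φ * ℓ (‖φ t‖ / N1 φ)) := by
    filter_upwards [hae] with t ht
    rw [← ofReal_norm, ← ENNReal.ofReal_mul hc]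
    apply ENNReal.ofReal_le_ofReal
    rcases (norm_nonneg (φ t)).eq_or_lt with h0 | h0
    · rw [← h0]; simp [hℓ0]
    have e : ‖φ t‖ / N1 φ = (‖φ t‖ / M) * ‖I‖ := by
      rw [hN]; field_simp
    have hl : (‖φ t‖ / M) * ℓ ‖I‖ ≤ ℓ (‖φ t‖ / N1 φ) := by
      rw [e]
      rcases ht.eq_or_lt with h1 | h1
      · rw [h1, div_self hMpos.ne']; simp
      · exact hA1i _ _ (by positivity) (by rwa [div_lt_one hMpos]) hIpos
    calc ℓ ‖I‖ / ‖I‖ * ‖φ t‖ = N1 φ * ((‖φ t‖ / M) * ℓ ‖I‖) := by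
          rw [hN]; field_simp
      _ ≤ _ := mul_le_mul_of_nonneg_left hl hNpos.le
  unfold pathCost
  refine le_trans ?_ (lintegral_mono_ae key)
  rw [lintegral_const_mul _ hφ.enorm]
  have hle : ‖I‖ₑ ≤ ∫⁻ t in Icc (0:ℝ) 1, ‖φ t‖ₑ := by
    rw [hIdef, intervalIntegral.integral_of_le zero_le_one, ← integral_Icc_eq_integral_Ioc]
    exact enorm_integral_le_lintegral_enorm _
  calc ENNReal.ofReal (ℓ ‖I‖) = ENNReal.ofReal (ℓ ‖I‖ / ‖I‖) * ‖I‖ₑ := by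
        rw [← ofReal_norm, ← ENNReal.ofReal_mul hc]
        congr 1; field_simp
    _ ≤ _ := by gcongr

lemma aux_int {d : ℕ} (x y : Vec d) (A : Set ℝ) (hA : MeasurableSet A)
    (hs : A ⊆ Icc (0:ℝ) 1) (hpos : x ≠ y → 0 < volume A) :
    (∫ s in (0:ℝ)..1, XVel x y A s) = y - x := by
  by_cases hxy : x = y
  · simp [XVel, hxy]
  have hp := hpos hxy
  have hfin : volume A ≠ ⊤ := ((measure_mono hs).trans_lt (by simp)).ne
  have e : XVel x y A = A.indicator (fun _ => ((volume A).toReal)⁻¹ • (y - x)) := by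
    ext1 s; simp [XVel, hxy, hp, indicator_apply]
  have hr : (volume A).toReal ≠ 0 := (ENNReal.toReal_pos hp.ne' hfin).ne'
  rw [intervalIntegral.integral_of_le zero_le_one, ← integral_Icc_eq_integral_Ioc, e,
    setIntegral_indicator hA, inter_eq_self_of_subset_right hs, setIntegral_const, smul_smul,
    Measure.real, mul_inv_cancel₀ hr, one_smul]

lemma aux_esup {d : ℕ} (x y : Vec d) (A : Set ℝ) (hA : MeasurableSet A)
    (hs : A ⊆ Icc (0:ℝ) 1) :
    eSup01 (XVel x y A) ≤ ENNReal.ofReal (((volume A).toReal)⁻¹ * ‖y - x‖) := by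
  unfold eSup01 eSupT
  refine essSup_le_of_ae_le _ (Eventually.of_forall fun s => ?_)
  have h : ‖XVel x y A s‖ ≤ ((volume A).toReal)⁻¹ * ‖y - x‖ := by
    unfold XVel
    split_ifs
    · rw [norm_smul]; simp
    · simp; positivity
    · simp; positivity
  show (‖XVel x y A s‖₊ : ℝ≥0∞) ≤ _
  rw [← enorm_eq_nnnorm, ← ofReal_norm]
  exact ENNReal.ofReal_le_ofReal h

lemma aux_esup' {d : ℕ} (x y : Vec d) (A : Set ℝ) (hA : MeasurableSet A)
    (hs : A ⊆ Icc (0:ℝ) 1) (hxy : x ≠ y) (hp : 0 < volume A) :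
    (eSupT (XVel x y A) 1).toReal = ((volume A).toReal)⁻¹ * ‖y - x‖ := by
  have h1 := aux_esup x y A hA hs
  have hnn : 0 ≤ ((volume A).toReal)⁻¹ * ‖y - x‖ := by positivity
  apply le_antisymm
  · exact ENNReal.toReal_le_of_le_ofReal hnn h1
  have hae := ENNReal.ae_le_essSup (μ := volume.restrict (Icc (0:ℝ) 1))
      (fun s => (‖XVel x y A s‖₊ : ℝ≥0∞))
  rw [ae_restrict_iff' measurableSet_Icc] at hae
  have : ∃ s ∈ A, (‖XVel x y A s‖₊ : ℝ≥0∞) ≤ eSupT (XVel x y A) 1 := by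
    by_contra hcon
    push Not at hcon
    have : volume A = 0 := by
      refine measure_mono_null ?_ (ae_iff.mp hae)
      intro s hsA h
      exact absurd (h (hs hsA)) (not_le.mpr (hcon s hsA))
    exact hp.ne' this
  obtain ⟨s, hsA, h⟩ := this
  have hfin : eSupT (XVel x y A) 1 ≠ ⊤ := (h1.trans_lt ENNReal.ofReal_lt_top).ne
  have h3 := ENNReal.toReal_mono hfin h
  have e : ‖XVel x y A s‖ = ((volume A).toReal)⁻¹ * ‖y - x‖ := by
    simp [XVel, hxy, hp, hsA, norm_smul]
  rw [← e]
  simpa using h3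

lemma aux_cost {d : ℕ} (ℓ : ℝ → ℝ) (hℓ0 : ℓ 0 = 0)
    (x y : Vec d) (A : Set ℝ) (hA : MeasurableSet A)
    (hs : A ⊆ Icc (0:ℝ) 1) (hpos : x ≠ y → 0 < volume A) :
    pathCost ℓ N1 (XVel x y A) = ENNReal.ofReal (ℓ ‖y - x‖) := by
  by_cases hxy : x = y
  · simp [pathCost, XVel, hxy, hℓ0]
  have hp := hpos hxy
  have hfin : volume A ≠ ⊤ := ((measure_mono hs).trans_lt (by simp)).ne
  have hr : 0 < (volume A).toReal := ENNReal.toReal_pos hp.ne' hfin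
  have hn : y - x ≠ 0 := sub_ne_zero.mpr (Ne.symm hxy)
  have hn' : ‖y - x‖ ≠ 0 := norm_ne_zero_iff.mpr hn
  have hN : N1 (XVel x y A) = ((volume A).toReal)⁻¹ := by
    unfold N1 N1T
    rw [aux_int x y A hA hs hpos, if_pos hn, aux_esup' x y A hA hs hxy hp]
    field_simp
  unfold pathCost
  rw [hN]
  have e : (fun t => ENNReal.ofReal (((volume A).toReal)⁻¹ *
      ℓ (‖XVel x y A t‖ / ((volume A).toReal)⁻¹))) =
      A.indicator (fun _ => ENNReal.ofReal (((volume A).toReal)⁻¹ * ℓ ‖y - x‖)) := by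
    ext1 t
    by_cases ht : t ∈ A
    · have : ‖XVel x y A t‖ / ((volume A).toReal)⁻¹ = ‖y - x‖ := by
        simp only [XVel, ne_eq, hxy, not_false_eq_true, hp, and_self, if_true, ht, norm_smul,
          norm_inv, Real.norm_eq_abs, abs_of_pos hr]
        field_simp
      rw [this, indicator_of_mem ht]
    · simp [XVel, ht, hℓ0]
  rw [e, lintegral_indicator hA, setLIntegral_const, Measure.restrict_apply hA,
    inter_eq_self_of_subset_left hs, ENNReal.ofReal_mul (by positivity),
    ENNReal.ofReal_inv_of_pos hr, ENNReal.ofReal_toReal hfin, mul_right_comm,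
    ENNReal.inv_mul_cancel hp.ne' hfin, one_mul]

lemma aux_meas {d : ℕ} (Ω : Type) [MeasureSpace Ω] (X₀ X₁ : Ω → Vec d) (h0 : Measurable X₀)
    (h1 : Measurable X₁) (A : Ω → Set ℝ) (hA : IsRandomSet Ω A) :
    Measurable (Function.uncurry (fun ω => XVel (X₀ ω) (X₁ ω) (A ω))) := by
  have hv : Measurable (fun ω => volume (A ω)) := measurable_measure_prodMk_left hA.2
  have hS : MeasurableSet {ω | X₀ ω ≠ X₁ ω ∧ 0 < volume (A ω)} :=
    (measurableSet_eq_fun h0 h1).compl.inter (measurableSet_lt measurable_const hv)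
  refine Measurable.ite (p := fun p : Ω × ℝ => X₀ p.1 ≠ X₁ p.1 ∧ 0 < volume (A p.1))
    (measurable_fst hS) ?_ measurable_const
  refine Measurable.ite hA.2 ?_ measurable_const
  have hv' : Measurable (fun p : Ω × ℝ => ((volume (A p.1)).toReal)⁻¹) :=
    (hv.comp measurable_fst).ennreal_toReal.inv
  exact hv'.smul ((h1.comp measurable_fst).sub (h0.comp measurable_fst))

lemma aux_endPt {d : ℕ} (Ω : Type) [MeasureSpace Ω] (ξ : Ω → Vec d) (φ : Ω → ℝ → Vec d)
    (h0 : Measurable ξ) (h : Measurable (Function.uncurry φ)) :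
    Measurable (fun ω => endPt (ξ ω) (φ ω)) := by
  unfold endPt
  refine h0.add ?_
  simp only [intervalIntegral.integral_of_le zero_le_one]
  exact (h.stronglyMeasurable.integral_prod_right
    (ν := volume.restrict (Ioc (0:ℝ) 1))).measurable

/-- Theorem 2.1 (ii): under (A1,i), if `(X₀,X₁)` is a minimizer of
`T(P₀,P₁)` and `A` is a random measurable subset of `[0,1]` on the same probability space
with `P(|A| > 0 | X₀ ≠ X₁) = 1`, then `t ↦ X(t;X₀,X₁,A)` (whose start point is `X₀` and
whose velocity process is `XVel (X₀ ω) (X₁ ω) (A ω)`) is a minimizer of `Ṽ₁(P₀,P₁)`. -/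
theorem statement1 {d : ℕ} (hd : 1 ≤ d) (ℓ : ℝ → ℝ)
    (hℓnn : ∀ u : ℝ, 0 ≤ u → 0 ≤ ℓ u) (hℓ0 : ℓ 0 = 0)
    (hA1i : ∀ r u : ℝ, 0 < r → r < 1 → 0 < u → r * ℓ u ≤ ℓ (r * u))
    (P₀ P₁ : Measure (Vec d)) [IsProbabilityMeasure P₀] [IsProbabilityMeasure P₁]
    (Ω : Type) [MeasureSpace Ω] (X₀ X₁ : Ω → Vec d)
    (hmin : IsTMin (fun u => ℓ ‖u‖) P₀ P₁ Ω X₀ X₁)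
    (A : Ω → Set ℝ) (hA : IsRandomSet Ω A)
    (hApos : ∀ᵐ ω ∂(volume : Measure Ω), X₀ ω ≠ X₁ ω → 0 < volume (A ω)) :
    IsVtildeMin ℓ N1 P₀ P₁ Ω X₀ (fun ω => XVel (X₀ ω) (X₁ ω) (A ω)) := by
  obtain ⟨hP, hX0, hX1, hm0, hm1, hmk⟩ := hmin
  have hAm : ∀ ω, MeasurableSet (A ω) := fun ω => measurable_prodMk_left hA.2
  have hφ := aux_meas Ω X₀ X₁ hX0 hX1 A hA
  have hadm : IsAdmissible P₀ P₁ Ω X₀ (fun ω => XVel (X₀ ω) (X₁ ω) (A ω)) := by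
    refine ⟨hP, hX0, hφ, Eventually.of_forall fun ω =>
      (aux_esup _ _ _ (hAm ω) (hA.1 ω)).trans_lt ENNReal.ofReal_lt_top, hm0, ?_⟩
    rw [← hm1]
    apply Measure.map_congr
    filter_upwards [hApos] with ω hω
    simp [endPt, aux_int _ _ _ (hAm ω) (hA.1 ω) hω]
  refine ⟨hadm, ?_⟩
  apply le_antisymm
  · have e : (∫⁻ ω, pathCost ℓ N1 (XVel (X₀ ω) (X₁ ω) (A ω))) =
        ∫⁻ ω, ENNReal.ofReal (ℓ ‖X₁ ω - X₀ ω‖) := by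
      apply lintegral_congr_ae
      filter_upwards [hApos] with ω hω
      exact aux_cost ℓ hℓ0 _ _ _ (hAm ω) (hA.1 ω) hω
    rw [e, hmk]
    apply le_sInf
    rintro c ⟨Ω', m', ξ, φ, ⟨hP', hξ, hφ', hfin, hl0, hl1⟩, rfl⟩
    have hle : MKcost (fun u => ℓ ‖u‖) P₀ P₁ ≤
        ∫⁻ ω, ENNReal.ofReal (ℓ ‖endPt (ξ ω) (φ ω) - ξ ω‖) :=
      sInf_le ⟨Ω', m', hP', ξ, _, hξ, aux_endPt Ω' ξ φ hξ hφ', hl0, hl1, rfl⟩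
    refine hle.trans (lintegral_mono_ae ?_)
    filter_upwards [hfin] with ω hω
    have h := aux_lower ℓ hℓnn hℓ0 hA1i (φ ω) (hφ'.comp measurable_prodMk_left) hω
    simpa [endPt] using h
  · exact sInf_le ⟨Ω, _, _, _, hadm, rfl⟩
end

section
/- Let d ≥ 1 and let ℓ : [0,∞) → [0,∞) be such that there exists r₀ > 0 with ℓ strictly decreasing on [r₀,∞). Let P₀, P₁ be Borel probability measures on ℝ^d such that T(P₀,P₁) (with cost L(u) = ℓ(|u|)) has a minimizer (X₀,X₁) with P(|X₁−X₀| ≥ r₀) > 0. Then T(P₀,P₁) > Ṽ₂(P₀,P₁). -/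
open MeasureTheory Set Filter
open scoped ENNReal NNReal Classical

/-- a unit vector in direction `u` (arbitrary when `u = 0`). -/
noncomputable def unitDir {d : ℕ} (e0 u : Vec d) : Vec d := if u = 0 then e0 else ‖u‖⁻¹ • u

/-- back-and-forth velocity of constant speed `R` with displacement `u`. -/
noncomputable def bfVel {d : ℕ} (e0 u : Vec d) (R t : ℝ) : Vec d :=
  if t ≤ (1 + ‖u‖ / R) / 2 then R • unitDir e0 u else -(R • unitDir e0 u)

lemma norm_unitDir {d : ℕ} {e0 : Vec d} (he : ‖e0‖ = 1) (u : Vec d) : ‖unitDir e0 u‖ = 1 := by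
  unfold unitDir
  split_ifs with h
  · exact he
  · rw [norm_smul, norm_inv, norm_norm, inv_mul_cancel₀ (norm_ne_zero_iff.mpr h)]

lemma norm_smul_unitDir {d : ℕ} (e0 : Vec d) (u : Vec d) : ‖u‖ • unitDir e0 u = u := by
  unfold unitDir
  split_ifs with h
  · simp [h]
  · rw [smul_smul, mul_inv_cancel₀ (norm_ne_zero_iff.mpr h), one_smul]

lemma norm_bfVel {d : ℕ} {e0 : Vec d} (he : ‖e0‖ = 1) (u : Vec d) {R : ℝ} (hR : 0 ≤ R) (t : ℝ) :
    ‖bfVel e0 u R t‖ = R := by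
  unfold bfVel
  split_ifs <;> simp [norm_smul, norm_unitDir he, abs_of_nonneg hR]

lemma integral_bfVel {d : ℕ} (e0 : Vec d) (u : Vec d) {R : ℝ} (hR : ‖u‖ ≤ R) :
    ∫ t in (0:ℝ)..1, bfVel e0 u R t = u := by
  have hR0 : 0 ≤ R := (norm_nonneg u).trans hR
  set a := (1 + ‖u‖ / R) / 2 with ha
  set v := R • unitDir e0 u with hv
  have hq0 : 0 ≤ ‖u‖ / R := by positivity
  have hq1 : ‖u‖ / R ≤ 1 := div_le_one_of_le₀ hR hR0
  have ha0 : 0 ≤ a := by rw [ha]; linarith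
  have ha1 : a ≤ 1 := by rw [ha]; linarith
  have e1 : EqOn (fun _ => v) (bfVel e0 u R) (Ioc 0 a) := by
    intro t ht
    simp only [bfVel]
    rw [if_pos ht.2]
  have e2 : EqOn (fun _ => -v) (bfVel e0 u R) (Ioc a 1) := by
    intro t ht
    simp only [bfVel]
    rw [if_neg (not_le.mpr ht.1)]
  have i1 : IntervalIntegrable (bfVel e0 u R) volume 0 a := by
    refine (intervalIntegrable_const (c := v)).congr ?_
    rw [uIoc_of_le ha0]
    exact e1
  have i2 : IntervalIntegrable (bfVel e0 u R) volume a 1 := by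
    refine (intervalIntegrable_const (c := -v)).congr ?_
    rw [uIoc_of_le ha1]
    exact e2
  rw [← intervalIntegral.integral_add_adjacent_intervals i1 i2,
    intervalIntegral.integral_of_le ha0, intervalIntegral.integral_of_le ha1,
    ← setIntegral_congr_fun measurableSet_Ioc e1, ← setIntegral_congr_fun measurableSet_Ioc e2,
    ← intervalIntegral.integral_of_le ha0, ← intervalIntegral.integral_of_le ha1,
    intervalIntegral.integral_const, intervalIntegral.integral_const, smul_neg, ← sub_eq_add_neg,
    ← sub_smul, hv, smul_smul]
  have : (a - 0 - (1 - a)) * R = ‖u‖ := by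
    rcases hR0.eq_or_lt with h | h
    · rw [← h] at hR ⊢
      have := norm_nonneg u
      linarith
    · rw [ha]; field_simp; ring
  rw [this, norm_smul_unitDir]

lemma N2_eq_one {d : ℕ} {φ : ℝ → Vec d} {R : ℝ} (hR : 0 ≤ R) (h : ∀ t, ‖φ t‖ = R) :
    N2 φ = 1 := by
  unfold N2 N2T
  split_ifs with h0
  · have h1 : (∫ s in (0:ℝ)..1, ‖φ s‖) = R := by simp [h]
    have h2 : eSupT φ 1 = ENNReal.ofReal R := by
      unfold eSupT
      have : (fun s => (‖φ s‖₊ : ℝ≥0∞)) = fun _ => ENNReal.ofReal R := by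
        funext s
        rw [← h s, ofReal_norm_eq_enorm]; rfl
      rw [this, essSup_const]
      intro hh
      have := congrArg (fun μ => μ univ) hh
      simp at this
    rw [h1] at h0 ⊢
    rw [h2, ENNReal.toReal_ofReal hR, one_mul, div_self h0.ne']
  · rfl

lemma pathCost_const {d : ℕ} (ℓ : ℝ → ℝ) {φ : ℝ → Vec d} {R : ℝ} (hR : 0 ≤ R)
    (h : ∀ t, ‖φ t‖ = R) : pathCost ℓ N2 φ = ENNReal.ofReal (ℓ R) := by
  unfold pathCost
  simp [N2_eq_one hR h, h]

lemma eSup01_lt_top {d : ℕ} {φ : ℝ → Vec d} {R : ℝ} (h : ∀ t, ‖φ t‖ = R) :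
    eSup01 φ < ⊤ := by
  refine lt_of_le_of_lt (b := ENNReal.ofReal R) ?_ ENNReal.ofReal_lt_top
  unfold eSup01 eSupT
  refine essSup_le_of_ae_le _ (Eventually.of_forall fun s => ?_)
  rw [← h s, ofReal_norm_eq_enorm]; rfl

lemma Vtilde_le {d : ℕ} (hd : 1 ≤ d) (ℓ : ℝ → ℝ) (P₀ P₁ : Measure (Vec d))
    (Ω : Type) [MeasureSpace Ω] [IsProbabilityMeasure (volume : Measure Ω)] (X₀ X₁ : Ω → Vec d)
    (h0 : Measurable X₀) (h1 : Measurable X₁)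
    (hP0 : Measure.map X₀ volume = P₀) (hP1 : Measure.map X₁ volume = P₁)
    (R : ℝ → ℝ) (hRm : Measurable R) (hR : ∀ r, 0 ≤ r → r ≤ R r) :
    Vtilde ℓ N2 P₀ P₁ ≤ ∫⁻ ω, ENNReal.ofReal (ℓ (R ‖X₁ ω - X₀ ω‖)) := by
  obtain ⟨e0, he⟩ : ∃ e0 : Vec d, ‖e0‖ = 1 := ⟨EuclideanSpace.single ⟨0, hd⟩ 1, by simp⟩
  have hRu : ∀ u : Vec d, ‖u‖ ≤ R ‖u‖ := fun u => hR _ (norm_nonneg u)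
  have hR0 : ∀ u : Vec d, 0 ≤ R ‖u‖ := fun u => (norm_nonneg u).trans (hRu u)
  have hn : ∀ ω t, ‖bfVel e0 (X₁ ω - X₀ ω) (R ‖X₁ ω - X₀ ω‖) t‖ = R ‖X₁ ω - X₀ ω‖ :=
    fun ω t => norm_bfVel he _ (hR0 _) t
  refine sInf_le ⟨Ω, inferInstance, X₀,
    fun ω t => bfVel e0 (X₁ ω - X₀ ω) (R ‖X₁ ω - X₀ ω‖) t, ⟨inferInstance, h0, ?_, ?_, hP0, ?_⟩, ?_⟩
  · have hu : Measurable (fun p : Ω × ℝ => X₁ p.1 - X₀ p.1) :=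
      (h1.comp measurable_fst).sub (h0.comp measurable_fst)
    have hRR : Measurable (fun p : Ω × ℝ => R ‖X₁ p.1 - X₀ p.1‖) := hRm.comp hu.norm
    have hdir : Measurable (fun p : Ω × ℝ => unitDir e0 (X₁ p.1 - X₀ p.1)) := by
      have : Measurable (unitDir e0) := by
        unfold unitDir
        exact Measurable.ite (measurableSet_singleton (0 : Vec d)) measurable_const
          (measurable_norm.inv.smul measurable_id)
      exact this.comp hu
    have hv := hRR.smul hdir
    refine Measurable.ite (measurableSet_le measurable_snd ?_) hv hv.neg
    exact ((hu.norm.div hRR).const_add 1).div_const 2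
  · exact Eventually.of_forall fun ω => eSup01_lt_top (hn ω)
  · rw [← hP1]
    congr 1
    funext ω
    simp only [endPt]
    rw [integral_bfVel e0 _ (hRu _)]
    abel
  · exact lintegral_congr fun ω => (pathCost_const ℓ (hR0 _) (hn ω)).symm

/-- Proposition 2.1: if `ℓ` is strictly decreasing on `[r₀,∞)` for some
`r₀ > 0` and `T(P₀,P₁)` (with cost `ℓ(|u|)`) has a minimizer `(X₀,X₁)` with
`P(|X₁ - X₀| ≥ r₀) > 0`, then `T(P₀,P₁) > Ṽ₂(P₀,P₁)`. -/
theorem statement6 {d : ℕ} (hd : 1 ≤ d) (ℓ : ℝ → ℝ)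
    (hℓnn : ∀ u : ℝ, 0 ≤ u → 0 ≤ ℓ u)
    (r₀ : ℝ) (hr₀ : 0 < r₀)
    (hdec : ∀ u v : ℝ, r₀ ≤ u → u < v → ℓ v < ℓ u)
    (P₀ P₁ : Measure (Vec d)) [IsProbabilityMeasure P₀] [IsProbabilityMeasure P₁]
    (Ω : Type) [MeasureSpace Ω] (X₀ X₁ : Ω → Vec d)
    (hmin : IsTMin (fun u => ℓ ‖u‖) P₀ P₁ Ω X₀ X₁)
    (hpos : 0 < volume {ω | r₀ ≤ ‖X₁ ω - X₀ ω‖}) :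
    Vtilde ℓ N2 P₀ P₁ < MKcost (fun u => ℓ ‖u‖) P₀ P₁ := by
  obtain ⟨hprob, h0, h1, hP0, hP1, hc⟩ := hmin
  have hum : Measurable (fun ω => ‖X₁ ω - X₀ ω‖) := (h1.sub h0).norm
  have hanti : AntitoneOn ℓ (Ici r₀) := by
    intro u hu v hv huv
    rcases huv.eq_or_lt with h | h
    · rw [h]
    · exact (hdec u v hu h).le
  rcases eq_or_ne (MKcost (fun u => ℓ ‖u‖) P₀ P₁) ⊤ with htop | htop
  · rw [htop]
    refine lt_of_le_of_lt (Vtilde_le hd ℓ P₀ P₁ Ω X₀ X₁ h0 h1 hP0 hP1 (fun r => max r r₀)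
      (measurable_id.max measurable_const) (fun r _ => le_max_left _ _)) ?_
    refine lt_of_le_of_lt (b := ∫⁻ _ : Ω, ENNReal.ofReal (ℓ r₀)) ?_ (by simp)
    refine lintegral_mono fun ω => ENNReal.ofReal_le_ofReal ?_
    exact hanti (mem_Ici.2 le_rfl) (mem_Ici.2 (le_max_right _ _)) (le_max_right _ _)
  · set S := {ω | r₀ ≤ ‖X₁ ω - X₀ ω‖} with hS
    have hSm : MeasurableSet S := measurableSet_le measurable_const hum
    refine lt_of_le_of_lt (Vtilde_le hd ℓ P₀ P₁ Ω X₀ X₁ h0 h1 hP0 hP1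
      (fun r => if r₀ ≤ r then r + 1 else r)
      (Measurable.ite measurableSet_Ici (measurable_id.add_const 1) measurable_id)
      (fun r _ => by split_ifs <;> linarith)) ?_
    rw [← hc] at htop ⊢
    have hcompl : ∫⁻ ω in Sᶜ, ENNReal.ofReal (ℓ ‖X₁ ω - X₀ ω‖) ≠ ⊤ :=
      ne_top_of_le_ne_top htop (setLIntegral_le_lintegral _ _)
    rw [← lintegral_add_compl _ hSm, ← lintegral_add_compl (fun ω => ENNReal.ofReal (ℓ ‖X₁ ω - X₀ ω‖)) hSm]
    have hSc : ∫⁻ ω in Sᶜ, ENNReal.ofReal (ℓ (if r₀ ≤ ‖X₁ ω - X₀ ω‖ then ‖X₁ ω - X₀ ω‖ + 1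
        else ‖X₁ ω - X₀ ω‖)) = ∫⁻ ω in Sᶜ, ENNReal.ofReal (ℓ ‖X₁ ω - X₀ ω‖) := by
      refine setLIntegral_congr_fun hSm.compl fun ω hω => ?_
      have : ¬ r₀ ≤ ‖X₁ ω - X₀ ω‖ := hω
      simp only [if_neg this]
    rw [hSc]
    refine ENNReal.add_lt_add_right hcompl ?_
    have hlt : ∀ ω ∈ S, ENNReal.ofReal (ℓ (if r₀ ≤ ‖X₁ ω - X₀ ω‖ then ‖X₁ ω - X₀ ω‖ + 1
        else ‖X₁ ω - X₀ ω‖)) < ENNReal.ofReal (ℓ ‖X₁ ω - X₀ ω‖) := by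
      intro ω hω
      have hω' : r₀ ≤ ‖X₁ ω - X₀ ω‖ := hω
      rw [if_pos hω']
      have h := hdec _ (‖X₁ ω - X₀ ω‖ + 1) hω' (by linarith)
      exact (ENNReal.ofReal_lt_ofReal_iff
        (lt_of_le_of_lt (hℓnn _ (by linarith [norm_nonneg (X₁ ω - X₀ ω)])) h)).2 h
    have hganti : Antitone (fun r => ℓ (max r r₀)) := fun a b hab =>
      hanti (mem_Ici.2 (le_max_right _ _)) (mem_Ici.2 (le_max_right _ _)) (max_le_max_right _ hab)
    have hgm : Measurable (fun ω => ENNReal.ofReal (ℓ (max ‖X₁ ω - X₀ ω‖ r₀))) :=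
      (hganti.measurable.comp hum).ennreal_ofReal
    have hrm : AEMeasurable (fun ω => ENNReal.ofReal (ℓ ‖X₁ ω - X₀ ω‖)) (volume.restrict S) := by
      refine ⟨_, hgm, ?_⟩
      refine (ae_restrict_iff' hSm).2 (Eventually.of_forall fun ω hω => ?_)
      have hω' : r₀ ≤ ‖X₁ ω - X₀ ω‖ := hω
      simp only [max_eq_left hω']
    refine lintegral_strict_mono ?_ hrm ?_ ((ae_restrict_iff' hSm).2 (Eventually.of_forall hlt))
    · intro hh
      rw [Measure.restrict_eq_zero] at hh
      exact hpos.ne' hh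
    · refine ne_top_of_le_ne_top htop (le_trans ?_ (setLIntegral_le_lintegral S _))
      exact setLIntegral_mono' hSm fun ω hω => (hlt ω hω).le
end

section
/- Let d ≥ 1 and let ℓ : [0,∞) → [0,∞) satisfy (A1,i): ℓ(0) = 0 and ℓ(ru) ≥ rℓ(u) for all r ∈ (0,1), u > 0, and (A2,iii): ℓ is continuous on [0,∞) and ℓ(u) → ∞ as u → ∞. Then for any Borel probability measure P₀ on ℝ^d that is absolutely continuous with respect to Lebesgue measure and any bounded continuous f : ℝ^d → ℝ, inf{E[∫₀¹ L₁(t,X')dt + f(X(1))] : X ∈ A_∞(P₀, P^{X(1)})} = ∫_{ℝ^d} f^ℓ(x) P₀(dx), where f^ℓ(x) := inf{ℓ(|y−x|) + f(y) : y ∈ ℝ^d} and the infimum on the left is over processes X ∈ A_∞(P₀, P) for arbitrary terminal law P. -/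
open MeasureTheory Set Filter
open scoped ENNReal NNReal Classical

/-- Pathwise lower bound. -/
theorem path_lower {d : ℕ} (ℓ : ℝ → ℝ)
    (hℓnn : ∀ u : ℝ, 0 ≤ u → 0 ≤ ℓ u) (hℓ0 : ℓ 0 = 0)
    (hA1i : ∀ r u : ℝ, 0 < r → r < 1 → 0 < u → r * ℓ u ≤ ℓ (r * u))
    (hcont : ContinuousOn ℓ (Ici (0:ℝ))) (φ : ℝ → Vec d) (hφ : Measurable φ)
    (hs : eSup01 φ < ⊤) :
    ℓ ‖∫ s in (0:ℝ)..1, φ s‖ ≤ ∫ t in (0:ℝ)..1, N1 φ * ℓ (‖φ t‖ / N1 φ) := by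
  by_cases h0 : (∫ s in (0:ℝ)..1, φ s) = 0
  · have hN : N1 φ = 1 := by simp [N1, N1T, h0]
    rw [h0, norm_zero, hℓ0, hN]
    apply intervalIntegral.integral_nonneg (by norm_num)
    intro t _
    simpa using hℓnn _ (norm_nonneg _)
  set D := ‖∫ s in (0:ℝ)..1, φ s‖ with hD
  have hDpos : 0 < D := norm_pos_iff.mpr h0
  set m := (eSup01 φ).toReal with hm
  have hN : N1 φ = m / D := by
    simp only [N1, N1T]
    rw [if_pos h0, one_mul]; rfl
  have hbd : ∀ᵐ t ∂(volume.restrict (Icc (0:ℝ) 1)), ‖φ t‖ ≤ m := by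
    have := ENNReal.ae_le_essSup (μ := volume.restrict (Icc (0:ℝ) 1))
      (fun s => (‖φ s‖₊ : ℝ≥0∞))
    filter_upwards [this] with t ht
    have h2 := ENNReal.toReal_mono (b := eSup01 φ) hs.ne ht
    simpa using h2
  have hbd' : ∀ᵐ t ∂(volume.restrict (Ioc (0:ℝ) 1)), ‖φ t‖ ≤ m :=
    ae_restrict_of_ae_restrict_of_subset Ioc_subset_Icc_self hbd
  have hDm : D ≤ m := by
    have h := intervalIntegral.norm_integral_le_of_norm_le_const_ae (a := 0) (b := 1)
      (f := φ) (C := m) (by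
        rw [uIoc_of_le zero_le_one]
        exact (ae_restrict_iff' measurableSet_Ioc).mp hbd')
    simpa using h
  have hmpos : 0 < m := lt_of_lt_of_le hDpos hDm
  have hNpos : 0 < N1 φ := by rw [hN]; positivity
  -- pointwise bound
  have hkey : ∀ v : ℝ, 0 ≤ v → v ≤ D → v / D * ℓ D ≤ ℓ v := by
    intro v hv hvD
    rcases hv.eq_or_lt with rfl | hv
    · simp [hℓ0]
    rcases hvD.eq_or_lt with rfl | hvD
    · rw [div_self hv.ne', one_mul]
    have := hA1i (v / D) D (by positivity) ((div_lt_one hDpos).mpr hvD) hDpos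
    rwa [div_mul_cancel₀ _ hDpos.ne'] at this
  have hquot : ∀ t, ‖φ t‖ ≤ m → ‖φ t‖ / N1 φ ≤ D := by
    intro t ht
    rw [div_le_iff₀ hNpos, hN, mul_div_cancel₀ _ hDpos.ne']
    exact ht
  obtain ⟨B, hB⟩ := (isCompact_Icc (a := (0:ℝ)) (b := D)).exists_bound_of_continuousOn
    (hcont.mono Icc_subset_Ici_self)
  have hmeas : Measurable (fun t => N1 φ * ℓ (‖φ t‖ / N1 φ)) := by
    have hc : Continuous (fun u : ℝ => ℓ (max u 0)) := by
      apply hcont.comp_continuous (by fun_prop)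
      intro x; exact mem_Ici.mpr (le_max_right _ _)
    have h1 : Measurable (fun t => N1 φ * ℓ (max (‖φ t‖ / N1 φ) 0)) :=
      (hc.measurable.comp (hφ.norm.div_const _)).const_mul _
    convert h1 using 4 with t
    exact (max_eq_left (by positivity)).symm
  have hint : IntervalIntegrable (fun t => N1 φ * ℓ (‖φ t‖ / N1 φ)) volume 0 1 := by
    rw [intervalIntegrable_iff_integrableOn_Ioc_of_le zero_le_one]
    refine Measure.integrableOn_of_bounded (M := N1 φ * B) (by simp) hmeas.aestronglyMeasurable ?_
    filter_upwards [hbd'] with t ht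
    rw [norm_mul, Real.norm_of_nonneg hNpos.le]
    exact mul_le_mul_of_nonneg_left (hB _ ⟨by positivity, hquot t ht⟩) hNpos.le
  have hintφ : IntervalIntegrable (fun t => ‖φ t‖) volume 0 1 := by
    rw [intervalIntegrable_iff_integrableOn_Ioc_of_le zero_le_one]
    refine Measure.integrableOn_of_bounded (M := m) (by simp) hφ.norm.aestronglyMeasurable ?_
    filter_upwards [hbd'] with t ht
    simpa using ht
  have hmono : ∫ t in (0:ℝ)..1, ‖φ t‖ * (ℓ D / D) ≤
      ∫ t in (0:ℝ)..1, N1 φ * ℓ (‖φ t‖ / N1 φ) := by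
    apply intervalIntegral.integral_mono_ae_restrict zero_le_one (hintφ.mul_const _) hint
    filter_upwards [hbd] with t ht
    have := mul_le_mul_of_nonneg_left (hkey (‖φ t‖ / N1 φ) (by positivity) (hquot t ht)) hNpos.le
    refine le_trans (le_of_eq ?_) this
    field_simp
  refine le_trans ?_ hmono
  rw [intervalIntegral.integral_mul_const]
  have hn : D ≤ ∫ t in (0:ℝ)..1, ‖φ t‖ :=
    intervalIntegral.norm_integral_le_integral_norm zero_le_one
  calc ℓ D = D * (ℓ D / D) := by field_simp
    _ ≤ _ := mul_le_mul_of_nonneg_right hn (div_nonneg (hℓnn _ hDpos.le) hDpos.le)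

/-- Cost of a constant velocity. -/
theorem path_const {d : ℕ} (ℓ : ℝ → ℝ) (v : Vec d) :
    ∫ t in (0:ℝ)..1, N1 (fun _ : ℝ => v) * ℓ (‖v‖ / N1 (fun _ : ℝ => v)) = ℓ ‖v‖ := by
  have hN : N1 (fun _ : ℝ => v) = 1 := by
    unfold N1 N1T
    split_ifs with h
    · have hv : v ≠ 0 := by simpa using h
      have hne : volume.restrict (Icc (0:ℝ) 1) ≠ 0 := by
        simp [Measure.restrict_eq_zero]
      have : eSupT (fun _ : ℝ => v) 1 = (‖v‖₊ : ℝ≥0∞) := by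
        unfold eSupT; exact essSup_const _ hne
      rw [this]
      simp [hv]
    · rfl
  simp [hN]

/-- Measurable `ε`-optimal selection. -/
theorem exists_selection {d : ℕ} (g : Vec d → Vec d → ℝ) (F : Vec d → ℝ)
    (hg1 : ∀ y, Continuous (fun x => g x y)) (hg2 : ∀ x, Continuous (fun y => g x y))
    (hFm : Measurable F) (ε : ℝ) (hex0 : ∀ x, ∃ y, g x y < F x + ε) :
    ∃ Y : Vec d → Vec d, Measurable Y ∧ ∀ x, g x (Y x) < F x + ε := by
  have hex : ∀ x, ∃ n, g x (TopologicalSpace.denseSeq (Vec d) n) < F x + ε := by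
    intro x
    have ho : IsOpen {y | g x y < F x + ε} := isOpen_lt (hg2 x) continuous_const
    obtain ⟨n, hn⟩ := (TopologicalSpace.denseRange_denseSeq (Vec d)).exists_mem_open ho (hex0 x)
    exact ⟨n, hn⟩
  refine ⟨fun x => TopologicalSpace.denseSeq (Vec d) (Nat.find (hex x)), ?_,
    fun x => Nat.find_spec (hex x)⟩
  refine (measurable_from_nat (f := TopologicalSpace.denseSeq (Vec d))).comp ?_
  apply measurable_find
  intro n
  exact measurableSet_lt (hg1 _).measurable (hFm.add_const ε)

/-- Corollary 2.1: under (A1,i) and (A2,iii), for any `P₀ ≪ Lebesgue`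
and any bounded continuous `f`, the value of the finite-horizon control problem
`inf{E[∫₀¹ L₁(t,X')dt + f(X(1))] : X ∈ 𝒜_∞(P₀, P^{X(1)})}` (the infimum being over
processes with initial law `P₀` and arbitrary terminal law) equals `∫ f^ℓ dP₀`,
where `f^ℓ(x) = inf{ℓ(|y-x|) + f(y) : y ∈ ℝ^d}`. -/
theorem statement7 {d : ℕ} (hd : 1 ≤ d) (ℓ : ℝ → ℝ)
    (hℓnn : ∀ u : ℝ, 0 ≤ u → 0 ≤ ℓ u) (hℓ0 : ℓ 0 = 0)
    (hA1i : ∀ r u : ℝ, 0 < r → r < 1 → 0 < u → r * ℓ u ≤ ℓ (r * u))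
    (hcont : ContinuousOn ℓ (Ici (0:ℝ))) (htop : Tendsto ℓ atTop atTop)
    (P₀ : Measure (Vec d)) [IsProbabilityMeasure P₀]
    (habs : P₀ ≪ (volume : Measure (Vec d)))
    (f : Vec d → ℝ) (hfc : Continuous f) (hfb : ∃ C : ℝ, ∀ x, |f x| ≤ C) :
    sInf { c : ℝ |
      ∃ (Ω : Type) (_ : MeasureSpace Ω), IsProbabilityMeasure (volume : Measure Ω) ∧
        ∃ (ξ : Ω → Vec d) (φ : Ω → ℝ → Vec d),
          Measurable ξ ∧ Measurable (Function.uncurry φ) ∧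
          (∀ᵐ ω ∂(volume : Measure Ω), eSup01 (φ ω) < ⊤) ∧
          Measure.map ξ volume = P₀ ∧
          Integrable (fun ω =>
            (∫ t in (0:ℝ)..1, N1 (φ ω) * ℓ (‖φ ω t‖ / N1 (φ ω)))
              + f (endPt (ξ ω) (φ ω))) ∧
          c = ∫ ω, ((∫ t in (0:ℝ)..1, N1 (φ ω) * ℓ (‖φ ω t‖ / N1 (φ ω)))
              + f (endPt (ξ ω) (φ ω))) }
      = ∫ x, (⨅ y : Vec d, (ℓ ‖y - x‖ + f y)) ∂P₀ := by
  obtain ⟨C, hC⟩ := hfb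
  set g : Vec d → Vec d → ℝ := fun x y => ℓ ‖y - x‖ + f y with hg
  set F : Vec d → ℝ := fun x => ⨅ y : Vec d, g x y with hF
  have hlow : ∀ x y, -C ≤ g x y := fun x y => by
    have h1 := hℓnn _ (norm_nonneg (y - x))
    have h2 := (abs_le.mp (hC y)).1
    simp only [hg]; linarith
  have hbdd : ∀ x, BddBelow (range (g x)) := fun x => ⟨-C, by rintro _ ⟨y, rfl⟩; exact hlow x y⟩
  have hFle : ∀ x y, F x ≤ g x y := fun x y => ciInf_le (hbdd x) y
  have hFlow : ∀ x, -C ≤ F x := fun x => le_ciInf (hlow x)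
  have hFup : ∀ x, F x ≤ C := fun x => by
    have h1 := hFle x x
    have h2 := (abs_le.mp (hC x)).2
    simp only [hg, sub_self, norm_zero, hℓ0] at h1
    linarith
  have hgc : Continuous (fun p : Vec d × Vec d => g p.1 p.2) := by
    apply Continuous.add _ (hfc.comp continuous_snd)
    apply hcont.comp_continuous (by fun_prop)
    intro x; exact norm_nonneg _
  have hgc1 : ∀ y, Continuous (fun x => g x y) := fun y =>
    by
    apply Continuous.add _ continuous_const
    apply hcont.comp_continuous (by fun_prop)
    intro x; exact norm_nonneg _
  have hgc2 : ∀ x, Continuous (fun y => g x y) := fun x =>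
    by
    apply Continuous.add _ hfc
    apply hcont.comp_continuous (by fun_prop)
    intro x; exact norm_nonneg _
  have hFm : Measurable F := by
    apply measurable_of_Iio
    intro a
    have : F ⁻¹' Iio a = ⋃ y, {x | g x y < a} := by
      ext x
      simp only [mem_preimage, mem_Iio, mem_iUnion, Set.mem_ofPred_eq]
      exact ciInf_lt_iff (hbdd x)
    rw [this]
    apply IsOpen.measurableSet
    apply isOpen_iUnion
    intro y
    exact isOpen_lt (hgc1 y) continuous_const
  have hFi : Integrable F P₀ := by
    refine Integrable.of_bound hFm.aestronglyMeasurable C (ae_of_all _ fun x => ?_)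
    exact abs_le.mpr ⟨hFlow x, hFup x⟩
  -- lower bound
  have hlb : ∀ c ∈ { c : ℝ |
      ∃ (Ω : Type) (_ : MeasureSpace Ω), IsProbabilityMeasure (volume : Measure Ω) ∧
        ∃ (ξ : Ω → Vec d) (φ : Ω → ℝ → Vec d),
          Measurable ξ ∧ Measurable (Function.uncurry φ) ∧
          (∀ᵐ ω ∂(volume : Measure Ω), eSup01 (φ ω) < ⊤) ∧
          Measure.map ξ volume = P₀ ∧
          Integrable (fun ω =>
            (∫ t in (0:ℝ)..1, N1 (φ ω) * ℓ (‖φ ω t‖ / N1 (φ ω)))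
              + f (endPt (ξ ω) (φ ω))) ∧
          c = ∫ ω, ((∫ t in (0:ℝ)..1, N1 (φ ω) * ℓ (‖φ ω t‖ / N1 (φ ω)))
              + f (endPt (ξ ω) (φ ω))) }, ∫ x, F x ∂P₀ ≤ c := by
    rintro c ⟨Ω, _, hp, ξ, φ, hξ, hφ, hs, hmap, hint, rfl⟩
    rw [← hmap, integral_map hξ.aemeasurable hFm.aestronglyMeasurable]
    have hFi2 : Integrable (fun ω => F (ξ ω)) := by
      rw [← hmap] at hFi
      exact hFi.comp_measurable hξ
    apply integral_mono_ae hFi2 hint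
    filter_upwards [hs] with ω hω
    have h1 := path_lower ℓ hℓnn hℓ0 hA1i hcont (φ ω) (hφ.comp measurable_prodMk_left) hω
    have h2 := hFle (ξ ω) (endPt (ξ ω) (φ ω))
    simp only [hg, endPt, add_sub_cancel_left] at h2
    simp only [endPt]
    linarith
  -- near-optimal controls
  have hub : ∀ ε : ℝ, 0 < ε → ∃ c ∈ { c : ℝ |
      ∃ (Ω : Type) (_ : MeasureSpace Ω), IsProbabilityMeasure (volume : Measure Ω) ∧
        ∃ (ξ : Ω → Vec d) (φ : Ω → ℝ → Vec d),
          Measurable ξ ∧ Measurable (Function.uncurry φ) ∧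
          (∀ᵐ ω ∂(volume : Measure Ω), eSup01 (φ ω) < ⊤) ∧
          Measure.map ξ volume = P₀ ∧
          Integrable (fun ω =>
            (∫ t in (0:ℝ)..1, N1 (φ ω) * ℓ (‖φ ω t‖ / N1 (φ ω)))
              + f (endPt (ξ ω) (φ ω))) ∧
          c = ∫ ω, ((∫ t in (0:ℝ)..1, N1 (φ ω) * ℓ (‖φ ω t‖ / N1 (φ ω)))
              + f (endPt (ξ ω) (φ ω))) }, c ≤ (∫ x, F x ∂P₀) + ε := by
    intro ε hε
    obtain ⟨Y, hY, hYg⟩ := exists_selection g F hgc1 hgc2 hFm ε (fun x =>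
      exists_lt_of_ciInf_lt (lt_add_of_pos_right (F x) hε))
    have hcost : ∀ x, (∫ t in (0:ℝ)..1, N1 (fun _ : ℝ => Y x - x) *
        ℓ (‖Y x - x‖ / N1 (fun _ : ℝ => Y x - x))) + f (endPt x (fun _ => Y x - x)) = g x (Y x) := by
      intro x
      rw [path_const]
      simp [endPt, hg]
    have hgi : Integrable (fun x => g x (Y x)) P₀ := by
      refine Integrable.of_bound
        (hgc.measurable.comp (measurable_id.prodMk hY)).aestronglyMeasurable (C + ε)
        (ae_of_all _ fun x => ?_)
      have h1 := hlow x (Y x)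
      have h2 := hYg x
      have h3 := hFup x
      exact abs_le.mpr ⟨by linarith, by linarith⟩
    refine ⟨∫ x, g x (Y x) ∂P₀, ⟨Vec d, ⟨P₀⟩, inferInstance, id, fun x _ => Y x - x,
      measurable_id, ?_, ?_, ?_, ?_, ?_⟩, ?_⟩
    · exact (hY.sub measurable_id).comp measurable_fst
    · refine ae_of_all _ fun x => ?_
      refine lt_of_le_of_lt (essSup_le_of_ae_le (‖Y x - x‖₊ : ℝ≥0∞) (ae_of_all _ fun _ => le_rfl))
        ENNReal.coe_lt_top
    · exact Measure.map_id
    · simp only [id, hcost]; exact hgi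
    · simp only [id, hcost]
    · calc ∫ x, g x (Y x) ∂P₀ ≤ ∫ x, (F x + ε) ∂P₀ :=
            integral_mono hgi (hFi.add (integrable_const ε)) fun x => (hYg x).le
        _ = _ := by rw [integral_add hFi (integrable_const ε)]; simp
  apply le_antisymm
  · apply le_of_forall_pos_le_add
    intro ε hε
    obtain ⟨c, hc, hle⟩ := hub ε hε
    exact (csInf_le ⟨_, hlb⟩ hc).trans hle
  · obtain ⟨c, hc, -⟩ := hub 1 one_pos
    exact le_csInf ⟨c, hc⟩ hlb
end

section
/- Let d ≥ 1 and let ℓ : [0,∞) → [0,∞) satisfy (A1,i): ℓ(0) = 0 and ℓ(ru) ≥ rℓ(u) for all r ∈ (0,1), u > 0. Then for any Borel probability measures P₀, P₁ on ℝ^d and any set B of Borel probability measures on [0,∞), V(P₀,P₁;B) = T^V(P₀,P₁;B). -/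
open MeasureTheory Set Filter
open scoped ENNReal NNReal Classical

theorem aux_ae_bound {d : ℕ} {φ : ℝ → Vec d} {M : ℝ} (hM : 0 ≤ M)
    (h : eSup01 φ ≤ ENNReal.ofReal M) :
    ∀ᵐ t ∂(volume.restrict (Icc (0:ℝ) 1)), ‖φ t‖ ≤ M := by
  have h1 := ENNReal.ae_le_essSup (μ := volume.restrict (Icc (0:ℝ) 1))
    (fun s => (‖φ s‖₊ : ℝ≥0∞))
  filter_upwards [h1] with t ht
  have h2 : (‖φ t‖₊ : ℝ≥0∞) ≤ ENNReal.ofReal M := ht.trans h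
  rw [← enorm_eq_nnnorm, ← ofReal_norm] at h2
  exact (ENNReal.ofReal_le_ofReal_iff hM).1 h2

theorem aux_norm {d : ℕ} (ξ : Vec d) (φ : ℝ → Vec d) {M : ℝ}
    (h : ∀ᵐ t ∂(volume.restrict (Icc (0:ℝ) 1)), ‖φ t‖ ≤ M) :
    ‖endPt ξ φ - ξ‖ ≤ M := by
  unfold endPt
  rw [add_sub_cancel_left]
  have h2 := (ae_restrict_iff' measurableSet_Icc).1 h
  have := intervalIntegral.norm_integral_le_of_norm_le_const_ae (a := 0) (b := 1) (f := φ) (C := M)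
    (by
      filter_upwards [h2] with t ht hm
      rw [uIoc_of_le zero_le_one] at hm
      exact ht (Ioc_subset_Icc_self hm))
  simpa using this

theorem aux_enorm {d : ℕ} (ξ : Vec d) (φ : ℝ → Vec d) :
    ENNReal.ofReal ‖endPt ξ φ - ξ‖ ≤ ∫⁻ t in Icc (0:ℝ) 1, ENNReal.ofReal ‖φ t‖ := by
  unfold endPt
  rw [add_sub_cancel_left, intervalIntegral.integral_of_le zero_le_one,
    ← integral_Icc_eq_integral_Ioc, ofReal_norm]
  simp only [ofReal_norm]
  exact enorm_integral_le_lintegral_enorm _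

theorem aux_ell (ℓ : ℝ → ℝ) (hℓ0 : ℓ 0 = 0)
    (hA1i : ∀ r u : ℝ, 0 < r → r < 1 → 0 < u → r * ℓ u ≤ ℓ (r * u))
    {M a : ℝ} (hM : 0 < M) (ha : 0 ≤ a) (haM : a ≤ M) : ℓ M / M * a ≤ ℓ a := by
  rcases ha.eq_or_lt with rfl | ha
  · simp [hℓ0]
  rcases haM.eq_or_lt with rfl | haM
  · exact (div_mul_cancel₀ _ hM.ne').le
  · have := hA1i (a / M) M (by positivity) ((div_lt_one hM).2 haM) hM
    rw [div_mul_cancel₀ _ hM.ne'] at this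
    calc ℓ M / M * a = a / M * ℓ M := by ring
      _ ≤ _ := this

theorem aux_cost_s8 {d : ℕ} (ℓ : ℝ → ℝ) (hℓnn : ∀ u : ℝ, 0 ≤ u → 0 ≤ ℓ u) (hℓ0 : ℓ 0 = 0)
    (hA1i : ∀ r u : ℝ, 0 < r → r < 1 → 0 < u → r * ℓ u ≤ ℓ (r * u))
    (ξ : Vec d) (φ : ℝ → Vec d) {M : ℝ} (hM : 0 < M)
    (h : ∀ᵐ t ∂(volume.restrict (Icc (0:ℝ) 1)), ‖φ t‖ ≤ M) :
    ENNReal.ofReal (ℓ M / M * ‖endPt ξ φ - ξ‖) ≤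
      ∫⁻ t in Icc (0:ℝ) 1, ENNReal.ofReal (ℓ ‖φ t‖) := by
  have hc : 0 ≤ ℓ M / M := div_nonneg (hℓnn M hM.le) hM.le
  rw [ENNReal.ofReal_mul hc]
  calc _ ≤ ENNReal.ofReal (ℓ M / M) * ∫⁻ t in Icc (0:ℝ) 1, ENNReal.ofReal ‖φ t‖ := by
        gcongr; exact aux_enorm ξ φ
    _ = ∫⁻ t in Icc (0:ℝ) 1, ENNReal.ofReal (ℓ M / M) * ENNReal.ofReal ‖φ t‖ :=
        (lintegral_const_mul' _ _ ENNReal.ofReal_ne_top).symm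
    _ ≤ _ := by
        apply lintegral_mono_ae
        filter_upwards [h] with t ht
        rw [← ENNReal.ofReal_mul hc]
        exact ENNReal.ofReal_le_ofReal (aux_ell ℓ hℓ0 hA1i hM (norm_nonneg _) ht)

/-- the velocity moving along `D` at speed `M` until the displacement is `D`, then stopping -/
noncomputable def auxVel {d : ℕ} (D : Vec d) (M : ℝ) (s : ℝ) : Vec d :=
  if s ≤ ‖D‖ / M then (M / ‖D‖) • D else 0

theorem aux_vel_meas {d : ℕ} {Ω : Type} [MeasurableSpace Ω] {D : Ω → Vec d} {M : Ω → ℝ}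
    (hD : Measurable D) (hM : Measurable M) :
    Measurable (Function.uncurry fun ω => auxVel (D ω) (M ω)) := by
  unfold auxVel Function.uncurry
  refine Measurable.ite (measurableSet_le (by fun_prop) (by fun_prop)) (by fun_prop) (by fun_prop)

theorem aux_vel_norm {d : ℕ} (D : Vec d) {M : ℝ} (hM : 0 ≤ M) (s : ℝ) :
    ‖auxVel D M s‖ ≤ M := by
  unfold auxVel
  split_ifs
  · rw [norm_smul, Real.norm_of_nonneg (by positivity)]
    by_cases hz : ‖D‖ = 0
    · simpa [hz] using hM
    · exact (div_mul_cancel₀ _ hz).le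
  · simpa using hM

theorem aux_vel_eSup {d : ℕ} (D : Vec d) {M : ℝ} (hM : 0 ≤ M) :
    eSup01 (auxVel D M) ≤ ENNReal.ofReal M := by
  unfold eSup01 eSupT
  refine essSup_le_of_ae_le _ (Eventually.of_forall fun s => ?_)
  show (‖auxVel D M s‖₊ : ℝ≥0∞) ≤ _
  rw [← enorm_eq_nnnorm, ← ofReal_norm]
  exact ENNReal.ofReal_le_ofReal (aux_vel_norm D hM s)

theorem aux_vel_end {d : ℕ} (x y : Vec d) {M : ℝ} (hM : 0 ≤ M) (h : ‖y - x‖ ≤ M) :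
    endPt x (auxVel (y - x) M) = y := by
  unfold endPt
  set D := y - x with hD
  suffices H : ∫ s in (0:ℝ)..1, auxVel D M s = D by rw [H, hD]; abel
  have h0 : 0 ≤ ‖D‖ / M := by positivity
  have h1 : ‖D‖ / M ≤ 1 := div_le_one_of_le₀ h hM
  have e : ∀ s, auxVel D M s = (Iic (‖D‖ / M)).indicator (fun _ => (M / ‖D‖) • D) s := by
    intro s; simp [auxVel, indicator]
  simp only [e]
  rw [intervalIntegral.integral_of_le zero_le_one, setIntegral_indicator measurableSet_Iic,
    Ioc_inter_Iic, min_eq_right h1, setIntegral_const, smul_smul]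
  rw [measureReal_def, Real.volume_Ioc, sub_zero, ENNReal.toReal_ofReal h0]
  by_cases hz : ‖D‖ = 0
  · rw [norm_eq_zero.1 hz]; simp
  · have : M ≠ 0 := by
      rintro rfl; exact hz (le_antisymm h (norm_nonneg _))
    rw [show ‖D‖ / M * (M / ‖D‖) = 1 by field_simp, one_smul]

theorem aux_vel_cost {d : ℕ} (ℓ : ℝ → ℝ) (hℓnn : ∀ u : ℝ, 0 ≤ u → 0 ≤ ℓ u) (hℓ0 : ℓ 0 = 0)
    (D : Vec d) {M : ℝ} (hM : 0 ≤ M) :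
    ∫⁻ t in Icc (0:ℝ) 1, ENNReal.ofReal (ℓ ‖auxVel D M t‖) ≤
      if 0 < M then ENNReal.ofReal (ℓ M / M * ‖D‖) else 0 := by
  by_cases hz : ‖D‖ = 0
  · have : D = 0 := norm_eq_zero.1 hz
    subst this
    simp [auxVel, hℓ0]
  split_ifs with hp
  · have e : ∀ s, ENNReal.ofReal (ℓ ‖auxVel D M s‖)
        = (Iic (‖D‖ / M)).indicator (fun _ => ENNReal.ofReal (ℓ M)) s := by
      intro s
      unfold auxVel indicator
      simp only [mem_Iic]
      split_ifs
      · rw [norm_smul, Real.norm_of_nonneg (by positivity), div_mul_cancel₀ _ hz]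
      · simp [hℓ0]
    simp only [e]
    rw [setLIntegral_indicator measurableSet_Iic, setLIntegral_const]
    calc _ ≤ ENNReal.ofReal (ℓ M) * volume (Icc (0:ℝ) (‖D‖ / M)) := by
          gcongr
          rintro t ⟨a, b⟩
          simp only [mem_Icc, mem_Iic] at *
          exact ⟨b.1, a⟩
      _ = _ := by
          rw [Real.volume_Icc, ← ENNReal.ofReal_mul (hℓnn M hM)]
          congr 1; ring
  · have : M = 0 := le_antisymm (not_lt.1 hp) hM
    subst this
    simp [auxVel, hℓ0]

/-- Theorem 2.3 (i): under (A1,i), for any Borel probability measures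
`P₀, P₁` on `ℝ^d` and any set `B` of Borel probability laws (of the bound `M`),
`V(P₀,P₁;B) = T^V(P₀,P₁;B)`. -/
theorem statement8 {d : ℕ} (hd : 1 ≤ d) (ℓ : ℝ → ℝ)
    (hℓnn : ∀ u : ℝ, 0 ≤ u → 0 ≤ ℓ u) (hℓ0 : ℓ 0 = 0)
    (hA1i : ∀ r u : ℝ, 0 < r → r < 1 → 0 < u → r * ℓ u ≤ ℓ (r * u))
    (P₀ P₁ : Measure (Vec d)) [IsProbabilityMeasure P₀] [IsProbabilityMeasure P₁]
    (B : Set (Measure ℝ)) :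
    Vval ℓ P₀ P₁ B = TVval ℓ P₀ P₁ B := by
  apply le_antisymm
  · apply le_sInf
    rintro c ⟨Ω, _, hP, X₀, X₁, M, hX₀, hX₁, hM, hM0, hB, hb, h0, h1, rfl⟩
    refine (sInf_le ?_).trans (b := ∫⁻ ω, ∫⁻ t in Icc (0:ℝ) 1,
      ENNReal.ofReal (ℓ ‖auxVel (X₁ ω - X₀ ω) (M ω) t‖)) ?_
    · refine ⟨Ω, _, hP, X₀, fun ω => auxVel (X₁ ω - X₀ ω) (M ω), M, hX₀,
        aux_vel_meas (hX₁.sub hX₀) hM, hM, hM0, hB, ?_, h0, ?_, rfl⟩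
      · filter_upwards [hM0] with ω hω
        exact aux_vel_eSup _ hω
      · rw [← h1]
        apply Measure.map_congr
        filter_upwards [hM0, hb] with ω hω hω'
        exact aux_vel_end _ _ hω hω'
    · rw [← lintegral_indicator (measurableSet_lt measurable_const hM)]
      apply lintegral_mono_ae
      filter_upwards [hM0] with ω hω
      simpa [indicator] using aux_vel_cost ℓ hℓnn hℓ0 (X₁ ω - X₀ ω) hω
  · apply le_sInf
    rintro c ⟨Ω, _, hP, ξ, φ, M, hξ, hφ, hM, hM0, hB, hb, h0, h1, rfl⟩
    have hb' : ∀ᵐ ω ∂(volume : Measure Ω),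
        ∀ᵐ t ∂(volume.restrict (Icc (0:ℝ) 1)), ‖φ ω t‖ ≤ M ω := by
      filter_upwards [hM0, hb] with ω h h'
      exact aux_ae_bound h h'
    have hE : Measurable fun ω => endPt (ξ ω) (φ ω) := by
      unfold endPt
      refine hξ.add ?_
      simp only [intervalIntegral.integral_of_le zero_le_one]
      exact (hφ.stronglyMeasurable.integral_prod_right'
        (ν := volume.restrict (Ioc (0:ℝ) 1))).measurable
    refine (sInf_le ?_).trans (b := ∫⁻ ω in {ω | 0 < M ω},
      ENNReal.ofReal (ℓ (M ω) / M ω * ‖endPt (ξ ω) (φ ω) - ξ ω‖)) ?_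
    · refine ⟨Ω, _, hP, ξ, fun ω => endPt (ξ ω) (φ ω), M, hξ, hE, hM, hM0, hB, ?_, h0, h1, rfl⟩
      filter_upwards [hb'] with ω hω
      exact aux_norm _ _ hω
    · refine le_trans ?_ (setLIntegral_le_lintegral {ω | 0 < M ω} _)
      apply lintegral_mono_ae
      filter_upwards [ae_restrict_of_ae hb',
        ae_restrict_mem (measurableSet_lt measurable_const hM)] with ω hω hp
      exact aux_cost_s8 ℓ hℓnn hℓ0 hA1i _ _ hp hω
end
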